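/- The series $\sum_{m=1}^{\infty} \frac{r_2(m)^2}{m^2}$ converges, and moreover $\sum_{m > Y} \frac{r_2(m)^2}{m^2} \ll Y^{-1}\log(2Y)$ for all $Y \ge 1$. -/

import Mathlib

open scoped BigOperators

noncomputable def r2 (n : ℕ) : ℕ :=
  Nat.card {p : ℤ × ℤ // p.1 ^ 2 + p.2 ^ 2 = (n : ℤ)}

/-- The natural solutions of `x * y = z * w` in `[1, N]`, as pairs `((x, y), (z, w))`. -/
def mulEqMulNat (N : ℕ) : Finset ((ℕ × ℕ) × (ℕ × ℕ)) :=
  (((Finset.Icc 1 N) ×ˢ (Finset.Icc 1 N)) ×ˢ ((Finset.Icc 1 N) ×ˢ (Finset.Icc 1 N))).filter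
    fun q => q.1.1 * q.1.2 = q.2.1 * q.2.2

/-- The integer solutions of `x * y = z * w` in `[-N, N]`, as pairs `((x, y), (z, w))`. -/
noncomputable def mulEqMulInt (N : ℕ) : Finset ((ℤ × ℤ) × (ℤ × ℤ)) :=
  (((Finset.Icc (-N : ℤ) N) ×ˢ (Finset.Icc (-N : ℤ) N)) ×ˢ
    ((Finset.Icc (-N : ℤ) N) ×ˢ (Finset.Icc (-N : ℤ) N))).filter
    fun q => q.1.1 * q.1.2 = q.2.1 * q.2.2

lemma card_mulEqMulNat_le_sum (N : ℕ) :
    (mulEqMulNat N).card ≤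
      ∑ p ∈ Finset.Icc 1 N ×ˢ Finset.Icc 1 N, (N / max p.1 p.2) ^ 2 := by
  classical
  let P : Finset ((_ : ℕ × ℕ) × (ℕ × ℕ)) :=
    (Finset.Icc 1 N ×ˢ Finset.Icc 1 N).sigma fun p =>
      Finset.Icc 1 (N / max p.1 p.2) ×ˢ Finset.Icc 1 (N / max p.1 p.2)
  have hsub : mulEqMulNat N ⊆ P.image fun q =>
      ((q.2.1 * q.1.1, q.1.2 * q.2.2), (q.2.1 * q.1.2, q.1.1 * q.2.2)) := by
    rintro ⟨⟨x, y⟩, ⟨z, w⟩⟩ hq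
    simp only [mulEqMulNat, Finset.mem_filter, Finset.mem_product, Finset.mem_Icc] at hq
    obtain ⟨⟨⟨⟨hx1, hxN⟩, hy1, hyN⟩, ⟨hz1, hzN⟩, hw1, hwN⟩, heq⟩ := hq
    obtain ⟨g, s, ⟨t, rfl⟩, ⟨h, rfl⟩, rfl⟩ := exists_dvd_and_dvd_of_dvd_mul (Dvd.intro _ heq)
    have hg : 0 < g := Nat.pos_of_mul_pos_right hx1
    have hs : 0 < s := Nat.pos_of_mul_pos_left hx1
    have ht : 0 < t := Nat.pos_of_mul_pos_left hz1
    have hh : 0 < h := Nat.pos_of_mul_pos_left hw1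
    have hy : y = t * h := by
      apply Nat.eq_of_mul_eq_mul_left hx1
      rw [heq]; ring
    subst hy
    refine Finset.mem_image.2 ⟨⟨(s, t), (g, h)⟩, ?_, rfl⟩
    have hmax : 0 < max s t := lt_max_of_lt_left hs
    have hgm : g * max s t ≤ N := by
      rcases max_choice s t with e | e <;> rw [e] <;> assumption
    have hhm : h * max s t ≤ N := by
      rcases max_choice s t with e | e <;> rw [e, mul_comm] <;> assumption
    simp only [P, Finset.mem_sigma, Finset.mem_product, Finset.mem_Icc,
      Nat.le_div_iff_mul_le hmax]
    refine ⟨⟨⟨hs, ?_⟩, ht, ?_⟩, ⟨hg, hgm⟩, hh, hhm⟩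
    · exact (Nat.le_mul_of_pos_left s hg).trans hxN
    · exact (Nat.le_mul_of_pos_left t hg).trans hzN
  refine (Finset.card_le_card hsub).trans (Finset.card_image_le.trans ?_)
  simp [P, Finset.card_sigma, Finset.card_product, sq]

lemma sum_inv_max_sq_le (N : ℕ) :
    ∑ p ∈ Finset.Icc 1 N ×ˢ Finset.Icc 1 N, (((max p.1 p.2 : ℕ) : ℝ) ^ 2)⁻¹
      ≤ 2 * ∑ s ∈ Finset.Icc 1 N, (s : ℝ)⁻¹ := by
  have key : ∀ s ∈ Finset.Icc 1 N,
      ∑ t ∈ Finset.Icc 1 N, (if t ≤ s then ((s : ℝ) ^ 2)⁻¹ else 0) = (s : ℝ)⁻¹ := by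
    intro s hs
    obtain ⟨hs1, hsN⟩ := Finset.mem_Icc.1 hs
    have hf : (Finset.Icc 1 N).filter (fun t => t ≤ s) = Finset.Icc 1 s := by
      ext t
      simp only [Finset.mem_filter, Finset.mem_Icc]
      omega
    have hs0 : (s : ℝ) ≠ 0 := by positivity
    rw [← Finset.sum_filter, hf, Finset.sum_const, Nat.card_Icc, nsmul_eq_mul]
    simp only [Nat.add_sub_cancel]
    field_simp
  calc ∑ p ∈ Finset.Icc 1 N ×ˢ Finset.Icc 1 N, (((max p.1 p.2 : ℕ) : ℝ) ^ 2)⁻¹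
      ≤ ∑ p ∈ Finset.Icc 1 N ×ˢ Finset.Icc 1 N,
        ((if p.2 ≤ p.1 then ((p.1 : ℝ) ^ 2)⁻¹ else 0)
          + (if p.1 ≤ p.2 then ((p.2 : ℝ) ^ 2)⁻¹ else 0)) := by
        refine Finset.sum_le_sum fun p _ => ?_
        rcases le_total p.1 p.2 with h | h
        · rw [max_eq_right h, if_pos h]
          exact le_add_of_nonneg_left (by split_ifs <;> positivity)
        · rw [max_eq_left h, if_pos h]
          exact le_add_of_nonneg_right (by split_ifs <;> positivity)
    _ = 2 * ∑ s ∈ Finset.Icc 1 N, (s : ℝ)⁻¹ := by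
        rw [Finset.sum_add_distrib, Finset.sum_product, Finset.sum_product_right,
          Finset.sum_congr rfl key]
        ring

lemma card_mulEqMulNat_le (N : ℕ) :
    ((mulEqMulNat N).card : ℝ) ≤ 2 * (N : ℝ) ^ 2 * (1 + Real.log N) := by
  have hH : ∑ s ∈ Finset.Icc 1 N, (s : ℝ)⁻¹ ≤ 1 + Real.log N := by
    have := harmonic_le_one_add_log N
    rw [harmonic_eq_sum_Icc] at this
    push_cast at this
    exact this
  calc ((mulEqMulNat N).card : ℝ)
      ≤ ∑ p ∈ Finset.Icc 1 N ×ˢ Finset.Icc 1 N, ((N / max p.1 p.2 : ℕ) : ℝ) ^ 2 := by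
        exact_mod_cast card_mulEqMulNat_le_sum N
    _ ≤ ∑ p ∈ Finset.Icc 1 N ×ˢ Finset.Icc 1 N,
          (N : ℝ) ^ 2 * (((max p.1 p.2 : ℕ) : ℝ) ^ 2)⁻¹ := by
        refine Finset.sum_le_sum fun p _ => ?_
        rw [← div_eq_mul_inv, ← div_pow]
        gcongr
        exact Nat.cast_div_le
    _ = (N : ℝ) ^ 2 * ∑ p ∈ Finset.Icc 1 N ×ˢ Finset.Icc 1 N,
          (((max p.1 p.2 : ℕ) : ℝ) ^ 2)⁻¹ := by rw [Finset.mul_sum]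
    _ ≤ (N : ℝ) ^ 2 * (2 * (1 + Real.log N)) := by
        gcongr
        exact (sum_inv_max_sq_le N).trans (by gcongr)
    _ = _ := by ring

lemma card_mulEqMulInt_le_card (N : ℕ) :
    (mulEqMulInt N).card ≤ (2 * (2 * N + 1)) ^ 2 + 16 * (mulEqMulNat N).card := by
  classical
  let I : Finset ℤ := Finset.Icc (-N : ℤ) N
  let Z : Finset (ℤ × ℤ) := ({0} ×ˢ I) ∪ (I ×ˢ {0})
  let E : Finset ℤ := {1, -1}
  let S := ((E ×ˢ E) ×ˢ (E ×ˢ E)) ×ˢ mulEqMulNat N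
  have hI : I.card = 2 * N + 1 := by
    simp only [I, Int.card_Icc]
    omega
  have hZ : Z.card ≤ 2 * (2 * N + 1) := by
    refine (Finset.card_union_le _ _).trans (le_of_eq ?_)
    simp only [Finset.card_product, Finset.card_singleton, hI]
    ring
  have hsign : ∀ x : ℤ, ∃ e ∈ E, e * (x.natAbs : ℤ) = x := by
    intro x
    rcases Int.natAbs_eq x with h | h
    · exact ⟨1, by simp [E], by omega⟩
    · exact ⟨-1, by simp [E], by omega⟩
  have hsub : mulEqMulInt N ⊆ (Z ×ˢ Z) ∪ S.image fun q =>
      ((q.1.1.1 * (q.2.1.1 : ℤ), q.1.1.2 * (q.2.1.2 : ℤ)),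
        (q.1.2.1 * (q.2.2.1 : ℤ), q.1.2.2 * (q.2.2.2 : ℤ))) := by
    rintro ⟨⟨x, y⟩, ⟨z, w⟩⟩ hq
    simp only [mulEqMulInt, Finset.mem_filter, Finset.mem_product] at hq
    obtain ⟨⟨⟨hx, hy⟩, hz, hw⟩, heq⟩ := hq
    rw [Finset.mem_union]
    by_cases h0 : x * y = 0
    · left
      have h0' : z * w = 0 := heq ▸ h0
      have hmem : ∀ a b : ℤ, a ∈ I → b ∈ I → a * b = 0 → (a, b) ∈ Z := by
        intro a b ha hb hab
        rcases mul_eq_zero.1 hab with rfl | rfl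
        · simp [Z, hb]
        · simp [Z, ha]
      exact Finset.mem_product.2 ⟨hmem x y hx hy h0, hmem z w hz hw h0'⟩
    · right
      have h0' : z * w ≠ 0 := heq ▸ h0
      obtain ⟨a, ha, hax⟩ := hsign x
      obtain ⟨b, hb, hby⟩ := hsign y
      obtain ⟨c, hc, hcz⟩ := hsign z
      obtain ⟨d, hd, hdw⟩ := hsign w
      refine Finset.mem_image.2 ⟨(((a, b), (c, d)),
        ((x.natAbs, y.natAbs), (z.natAbs, w.natAbs))), ?_, by simp only [hax, hby, hcz, hdw]⟩
      have hpos : ∀ u : ℤ, u ∈ Finset.Icc (-N : ℤ) N → u ≠ 0 →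
          u.natAbs ∈ Finset.Icc 1 N := by
        intro u hu hu0
        rw [Finset.mem_Icc] at hu ⊢
        omega
      have habs : x.natAbs * y.natAbs = z.natAbs * w.natAbs := by
        rw [← Int.natAbs_mul, heq, Int.natAbs_mul]
      simp only [S, mulEqMulNat, Finset.mem_product, Finset.mem_filter]
      exact ⟨⟨⟨ha, hb⟩, hc, hd⟩, ⟨⟨hpos x hx (left_ne_zero_of_mul h0),
        hpos y hy (right_ne_zero_of_mul h0)⟩, hpos z hz (left_ne_zero_of_mul h0'),
        hpos w hw (right_ne_zero_of_mul h0')⟩, habs⟩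
  have hE : E.card = 2 := rfl
  refine (Finset.card_le_card hsub).trans ((Finset.card_union_le _ _).trans
    (add_le_add ?_ (Finset.card_image_le.trans ?_)))
  · rw [Finset.card_product, sq]
    exact Nat.mul_le_mul hZ hZ
  · simp only [S, Finset.card_product, hE]
    omega

lemma card_mulEqMulInt_le (N : ℕ) (hN : 1 ≤ N) :
    ((mulEqMulInt N).card : ℝ) ≤ 68 * (N : ℝ) ^ 2 * (1 + Real.log N) := by
  have h1 : ((mulEqMulInt N).card : ℝ) ≤
      (2 * (2 * (N : ℝ) + 1)) ^ 2 + 16 * ((mulEqMulNat N).card : ℝ) := by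
    exact_mod_cast card_mulEqMulInt_le_card N
  have h2 := card_mulEqMulNat_le N
  have hN' : (1 : ℝ) ≤ N := by exact_mod_cast hN
  have h3 : (2 * (2 * (N : ℝ) + 1)) ^ 2 ≤ 36 * (N : ℝ) ^ 2 := by nlinarith
  have h4 : 0 ≤ (N : ℝ) ^ 2 * Real.log N := by
    have := Real.log_nonneg hN'
    positivity
  nlinarith

lemma r2_eq_card_filter {m M : ℕ} (h : m ≤ M ^ 2) :
    r2 m = ((Finset.Icc (-M : ℤ) M ×ˢ Finset.Icc (-M : ℤ) M).filter
      fun p => p.1 ^ 2 + p.2 ^ 2 = (m : ℤ)).card := by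
  refine Nat.subtype_card _ fun p => ?_
  simp only [Finset.mem_filter, Finset.mem_product, Finset.mem_Icc, and_iff_right_iff_imp]
  intro hp
  have h' : (m : ℤ) ≤ (M : ℤ) ^ 2 := by exact_mod_cast h
  have hM : (0 : ℤ) ≤ M := Int.natCast_nonneg M
  exact ⟨abs_le.1 (abs_le_of_sq_le_sq (by nlinarith [sq_nonneg p.2]) hM),
    abs_le.1 (abs_le_of_sq_le_sq (by nlinarith [sq_nonneg p.1]) hM)⟩

lemma sum_r2_sq_le_card (M : ℕ) :
    ∑ m ∈ Finset.range (M ^ 2 + 1), r2 m ^ 2 ≤ (mulEqMulInt (2 * M)).card := by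
  classical
  let B := Finset.Icc (-M : ℤ) M ×ˢ Finset.Icc (-M : ℤ) M
  let R : ℕ → Finset (ℤ × ℤ) := fun m => B.filter fun p => p.1 ^ 2 + p.2 ^ 2 = (m : ℤ)
  have h1 : ∑ m ∈ Finset.range (M ^ 2 + 1), r2 m ^ 2 =
      ((Finset.range (M ^ 2 + 1)).biUnion fun m => R m ×ˢ R m).card := by
    rw [Finset.card_biUnion]
    · refine Finset.sum_congr rfl fun m hm => ?_
      rw [r2_eq_card_filter (Nat.lt_succ_iff.1 (Finset.mem_range.1 hm)),
        Finset.card_product, sq]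
    · intro m _ n _ hmn
      refine Finset.disjoint_left.2 fun q hq hq' => hmn ?_
      simp only [R, Finset.mem_product, Finset.mem_filter] at hq hq'
      have := hq.1.2.symm.trans hq'.1.2
      exact_mod_cast this
  rw [h1]
  refine Finset.card_le_card_of_injOn
    (fun q => ((q.1.1 - q.2.1, q.1.1 + q.2.1), (q.2.2 - q.1.2, q.2.2 + q.1.2))) ?_ ?_
  · rintro ⟨⟨a, b⟩, ⟨c, d⟩⟩ hq
    simp only [R, B, Finset.coe_biUnion, Set.mem_iUnion, Finset.mem_coe, Finset.mem_product,
      Finset.mem_filter, Finset.mem_Icc] at hq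
    obtain ⟨m, -, ⟨⟨⟨ha, ha'⟩, hb, hb'⟩, hab⟩, ⟨⟨hc, hc'⟩, hd, hd'⟩, hcd⟩ := hq
    simp only [mulEqMulInt, Finset.mem_coe, Finset.mem_filter, Finset.mem_product,
      Finset.mem_Icc]
    push_cast
    refine ⟨⟨⟨⟨?_, ?_⟩, ?_, ?_⟩, ⟨?_, ?_⟩, ?_, ?_⟩, ?_⟩
    all_goals linarith
  · rintro ⟨⟨a, b⟩, ⟨c, d⟩⟩ _ ⟨⟨a', b'⟩, ⟨c', d'⟩⟩ _ h
    simp only [Prod.mk.injEq] at h ⊢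
    omega

lemma sum_r2_sq_le {Y : ℝ} (hY : 1 ≤ Y) :
    ∑ m ∈ Finset.range (⌊Y⌋₊ + 1), (r2 m : ℝ) ^ 2 ≤ 4352 * Y * Real.log (2 * Y) := by
  set M := ⌈√Y⌉₊
  have hs1 : 1 ≤ √Y := Real.one_le_sqrt.2 hY
  have hss : √Y ^ 2 = Y := Real.sq_sqrt (by linarith)
  have hM1 : √Y ≤ M := Nat.le_ceil _
  have hM2 : (M : ℝ) < √Y + 1 := Nat.ceil_lt_add_one (by linarith)
  have hMN : 1 ≤ 2 * M := by
    have : (1 : ℝ) ≤ M := hs1.trans hM1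
    have : 1 ≤ M := by exact_mod_cast this
    omega
  have hfl : ⌊Y⌋₊ ≤ M ^ 2 := by
    have h : (⌊Y⌋₊ : ℝ) ≤ (M : ℝ) ^ 2 := (Nat.floor_le (by linarith)).trans (by nlinarith)
    exact_mod_cast h
  have hcard : ∑ m ∈ Finset.range (M ^ 2 + 1), (r2 m : ℝ) ^ 2 ≤
      ((mulEqMulInt (2 * M)).card : ℝ) := by
    exact_mod_cast sum_r2_sq_le_card M
  have hcount := card_mulEqMulInt_le (2 * M) hMN
  have hN1 : (1 : ℝ) ≤ ((2 * M : ℕ) : ℝ) := by exact_mod_cast hMN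
  have hN4 : ((2 * M : ℕ) : ℝ) ≤ 4 * √Y := by push_cast; linarith
  have hNsq : ((2 * M : ℕ) : ℝ) ^ 2 ≤ 16 * Y := by nlinarith
  have hlogN : Real.log ((2 * M : ℕ) : ℝ) ≤ 2 * Real.log (2 * Y) := by
    rw [show 2 * Real.log (2 * Y) = Real.log ((2 * Y) ^ 2) by rw [Real.log_pow]; norm_num]
    exact Real.log_le_log (by linarith) (by nlinarith)
  have hlog : 1 ≤ 2 * Real.log (2 * Y) := by
    have := Real.log_le_log (by norm_num) (by linarith : (2 : ℝ) ≤ 2 * Y)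
    linarith [Real.log_two_gt_d9]
  calc ∑ m ∈ Finset.range (⌊Y⌋₊ + 1), (r2 m : ℝ) ^ 2
      ≤ ∑ m ∈ Finset.range (M ^ 2 + 1), (r2 m : ℝ) ^ 2 :=
        Finset.sum_le_sum_of_subset_of_nonneg
          (Finset.range_mono (by omega)) fun _ _ _ => by positivity
    _ ≤ 68 * ((2 * M : ℕ) : ℝ) ^ 2 * (1 + Real.log ((2 * M : ℕ) : ℝ)) := hcard.trans hcount
    _ ≤ 68 * (16 * Y) * (4 * Real.log (2 * Y)) := by
        have := Real.log_nonneg hN1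
        gcongr
        linarith
    _ = 4352 * Y * Real.log (2 * Y) := by ring

lemma sum_dyadic_tail_le {Y : ℝ} (hY : 1 ≤ Y) (K : ℕ) :
    ∑ m ∈ Finset.range (⌊2 ^ K * Y⌋₊ + 1),
        (if Y < (m : ℝ) then (r2 m : ℝ) ^ 2 / (m : ℝ) ^ 2 else 0) ≤
      8704 * Y⁻¹ * Real.log (2 * Y) * (6 - (2 * K + 6) / 2 ^ K) := by
  have hY0 : 0 < Y := by linarith
  induction K with
  | zero =>
    refine le_of_eq ?_
    simp only [pow_zero, one_mul, Nat.cast_zero, mul_zero, zero_add, div_one, sub_self]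
    refine Finset.sum_eq_zero fun m hm => if_neg (not_lt.2 ?_)
    exact (Nat.le_floor_iff hY0.le).1 (Nat.lt_succ_iff.1 (Finset.mem_range.1 hm))
  | succ K ih =>
    have hpow : (1 : ℝ) ≤ 2 ^ K := one_le_pow₀ (by norm_num)
    have hX1 : (1 : ℝ) ≤ 2 ^ K * Y := by nlinarith
    have hX2 : (2 : ℝ) ^ K * Y ≤ 2 ^ (K + 1) * Y := by rw [pow_succ]; nlinarith
    have hmono : ⌊2 ^ K * Y⌋₊ + 1 ≤ ⌊2 ^ (K + 1) * Y⌋₊ + 1 := by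
      have := Nat.floor_mono hX2
      omega
    have hlog : Real.log (2 * (2 ^ (K + 1) * Y)) ≤ (K + 2) * Real.log (2 * Y) := by
      rw [show 2 * (2 ^ (K + 1) * Y) = 2 ^ (K + 1) * (2 * Y) by ring,
        Real.log_mul (by positivity) (by positivity), Real.log_pow]
      have := Real.log_le_log (by norm_num) (by linarith : (2 : ℝ) ≤ 2 * Y)
      push_cast
      nlinarith
    have hblock : ∑ m ∈ Finset.Ico (⌊2 ^ K * Y⌋₊ + 1) (⌊2 ^ (K + 1) * Y⌋₊ + 1),
        (if Y < (m : ℝ) then (r2 m : ℝ) ^ 2 / (m : ℝ) ^ 2 else 0) ≤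
        8704 * Y⁻¹ * Real.log (2 * Y) * ((K + 2) / 2 ^ K) := by
      calc ∑ m ∈ Finset.Ico (⌊2 ^ K * Y⌋₊ + 1) (⌊2 ^ (K + 1) * Y⌋₊ + 1),
            (if Y < (m : ℝ) then (r2 m : ℝ) ^ 2 / (m : ℝ) ^ 2 else 0)
          ≤ ∑ m ∈ Finset.Ico (⌊2 ^ K * Y⌋₊ + 1) (⌊2 ^ (K + 1) * Y⌋₊ + 1),
              (r2 m : ℝ) ^ 2 / (2 ^ K * Y) ^ 2 := by
            refine Finset.sum_le_sum fun m hm => ?_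
            have hm' : (2 : ℝ) ^ K * Y < m :=
              (Nat.floor_lt (by positivity)).1 (Finset.mem_Ico.1 hm).1
            split_ifs
            · gcongr
            · positivity
        _ ≤ ∑ m ∈ Finset.range (⌊2 ^ (K + 1) * Y⌋₊ + 1),
              (r2 m : ℝ) ^ 2 / (2 ^ K * Y) ^ 2 := by
            refine Finset.sum_le_sum_of_subset_of_nonneg (fun m hm => ?_)
              fun _ _ _ => by positivity
            exact Finset.mem_range.2 (Finset.mem_Ico.1 hm).2
        _ ≤ (4352 * (2 ^ (K + 1) * Y) * ((K + 2) * Real.log (2 * Y))) / (2 ^ K * Y) ^ 2 := by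
            rw [← Finset.sum_div]
            gcongr
            exact (sum_r2_sq_le (hX1.trans hX2)).trans (by gcongr)
        _ = 8704 * Y⁻¹ * Real.log (2 * Y) * ((K + 2) / 2 ^ K) := by
            rw [pow_succ]
            field_simp
            ring
    rw [← Finset.sum_range_add_sum_Ico _ hmono]
    refine (add_le_add ih hblock).trans (le_of_eq ?_)
    rw [pow_succ]
    push_cast
    field_simp
    ring

lemma sum_range_tail_le {Y : ℝ} (hY : 1 ≤ Y) (n : ℕ) :
    ∑ m ∈ Finset.range n, (if Y < (m : ℝ) then (r2 m : ℝ) ^ 2 / (m : ℝ) ^ 2 else 0) ≤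
      52224 * Y⁻¹ * Real.log (2 * Y) := by
  have hn : n ≤ ⌊2 ^ n * Y⌋₊ + 1 := by
    refine le_trans (Nat.le_floor ?_) (Nat.le_succ _)
    have h : (n : ℝ) ≤ 2 ^ n := by exact_mod_cast Nat.lt_two_pow_self.le
    nlinarith
  have hlog : 0 ≤ Real.log (2 * Y) := Real.log_nonneg (by linarith)
  calc _ ≤ _ := Finset.sum_le_sum_of_subset_of_nonneg (Finset.range_mono hn)
        fun _ _ _ => by split_ifs <;> positivity
    _ ≤ _ := sum_dyadic_tail_le hY n
    _ ≤ 8704 * Y⁻¹ * Real.log (2 * Y) * 6 := by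
        gcongr
        exact sub_le_self _ (by positivity)
    _ = _ := by ring

theorem stmt_10 :
    Summable (fun m : ℕ => (r2 m : ℝ) ^ 2 / (m : ℝ) ^ 2) ∧
    ∃ C : ℝ, 0 < C ∧ ∀ Y : ℝ, 1 ≤ Y →
      (∑' m : ℕ, if Y < (m : ℝ) then (r2 m : ℝ) ^ 2 / (m : ℝ) ^ 2 else 0)
        ≤ C * Y⁻¹ * Real.log (2 * Y) := by
  have hnonneg : ∀ (Y : ℝ) (m : ℕ),
      0 ≤ if Y < (m : ℝ) then (r2 m : ℝ) ^ 2 / (m : ℝ) ^ 2 else 0 := by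
    intro Y m
    split_ifs <;> positivity
  refine ⟨?_, 52224, by norm_num, fun Y hY =>
    Real.tsum_le_of_sum_range_le (hnonneg Y) (sum_range_tail_le hY)⟩
  have h := summable_of_sum_range_le (hnonneg 1) (sum_range_tail_le le_rfl)
  rw [← summable_nat_add_iff 2] at h ⊢
  refine h.congr fun m => if_pos ?_
  push_cast
  linarith [(Nat.cast_nonneg m : (0 : ℝ) ≤ m)]
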